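/- Let 0 < q < 1 be real, let ν be a real number that is not a negative integer, and let z > 0 be real. Then f(z) = I^{(2)}_ν((1−q²)z; q²) satisfies the second-order q-difference equation f(q^{−1}z) − (q^{−ν} + q^{ν})·f(z) + [1 − (1−q²)² z²/4]·f(qz) = 0. -/

import Mathlib

/-- The finite q-Pochhammer symbol `(a;q)_n = ∏_{j=0}^{n-1} (1 - a q^j)` (real version). -/
noncomputable def qPochR (a q : ℝ) (n : ℕ) : ℝ := ∏ j ∈ Finset.range n, (1 - a * q ^ j)

/-- The infinite q-Pochhammer symbol `(a;q)_∞ = ∏_{j=0}^{∞} (1 - a q^j)` (real version). -/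
noncomputable def qPochInfR (a q : ℝ) : ℝ := ∏' j : ℕ, (1 - a * q ^ j)

/-- The q²-Gamma function `Γ_{q²}(s) = ((q²;q²)_∞ / (q^{2s};q²)_∞) (1-q²)^{1-s}`,
with `q^{2s} = exp(2s ln q)`. -/
noncomputable def qGamma2 (q s : ℝ) : ℝ :=
  (qPochInfR (q ^ 2) (q ^ 2) / qPochInfR (Real.exp (2 * s * Real.log q)) (q ^ 2)) *
    (1 - q ^ 2) ^ (1 - s)

/-- The first modified q-Bessel function:
`I¹ q ν z = I^{(1)}_ν((1-q²)z; q²) = ∑_{k=0}^∞ (1-q²)^k (z/2)^{ν+2k} / ((q²;q²)_k Γ_{q²}(ν+k+1))`. -/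
noncomputable def I1 (q ν z : ℝ) : ℝ :=
  ∑' k : ℕ, (1 - q ^ 2) ^ k * (z / 2) ^ (ν + 2 * (k : ℝ)) /
    (qPochR (q ^ 2) (q ^ 2) k * qGamma2 q (ν + k + 1))

/-- The second modified q-Bessel function:
`I² q ν z = I^{(2)}_ν((1-q²)z; q²)
  = ∑_{k=0}^∞ q^{2k(ν+k)} (1-q²)^k (z/2)^{ν+2k} / ((q²;q²)_k Γ_{q²}(ν+k+1))`. -/
noncomputable def I2 (q ν z : ℝ) : ℝ :=
  ∑' k : ℕ, q ^ (2 * (k : ℝ) * (ν + k)) * (1 - q ^ 2) ^ k * (z / 2) ^ (ν + 2 * (k : ℝ)) /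
    (qPochR (q ^ 2) (q ^ 2) k * qGamma2 q (ν + k + 1))

/-- The q-derivative `∂_q f(z) = (f(z) - f(qz)) / ((1-q)z)`. -/
noncomputable def qDeriv (q : ℝ) (f : ℝ → ℝ) (z : ℝ) : ℝ := (f z - f (q * z)) / ((1 - q) * z)

open Filter Topology in
lemma aux_P (a p : ℝ) (hp0 : 0 < p) (hp1 : p < 1) :
    qPochInfR a p = (1 - a) * qPochInfR (a * p) p := by
  have hs : Summable (fun j : ℕ => ‖-(a * p * p ^ j)‖) := by
    simp only [norm_neg, norm_mul, norm_pow]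
    apply Summable.mul_left
    apply summable_geometric_of_lt_one (norm_nonneg _)
    rwa [Real.norm_of_nonneg hp0.le]
  have hm : Multipliable (fun j : ℕ => 1 - a * p ^ (j+1)) := by
    have := multipliable_one_add_of_summable hs
    refine this.congr (fun j => ?_)
    ring
  have h0 := tprod_eq_zero_mul' (f := fun j : ℕ => 1 - a * p ^ j) hm
  have h1 : (fun j : ℕ => 1 - a * p ^ (j + 1)) = fun j : ℕ => 1 - a * p * p ^ j := by
    funext j
    rw [pow_succ]; ring
  have h2 : qPochInfR (a * p) p = ∏' j : ℕ, (1 - a * p ^ (j + 1)) := by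
    rw [h1]; rfl
  have h3 : qPochInfR a p = ∏' j : ℕ, (1 - a * p ^ j) := rfl
  rw [h2, h3, h0, pow_zero, mul_one]

lemma aux_G (q s : ℝ) (hq0 : 0 < q) (hq1 : q < 1) :
    (qGamma2 q (s + 1))⁻¹ * (1 - Real.exp (2 * s * Real.log q)) =
      (1 - q ^ 2) * (qGamma2 q s)⁻¹ := by
  have hp1 : q ^ 2 < 1 := by nlinarith
  have hp0 : 0 < q ^ 2 := by positivity
  have hpos : 0 < 1 - q ^ 2 := by linarith
  unfold qGamma2
  have he : Real.exp (2 * (s + 1) * Real.log q) = Real.exp (2 * s * Real.log q) * q ^ 2 := by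
    rw [show 2 * (s + 1) * Real.log q = 2 * s * Real.log q + (Real.log q + Real.log q) by ring,
      Real.exp_add, Real.exp_add, Real.exp_log hq0]
    ring
  rw [aux_P (Real.exp (2 * s * Real.log q)) (q ^ 2) hp0 hp1, he]
  have h2 : (1 - q ^ 2) ^ (1 - s) = (1 - q ^ 2) ^ (1 - (s + 1)) * (1 - q ^ 2) := by
    rw [← Real.rpow_add_one hpos.ne']
    congr 1; ring
  rw [h2]
  simp only [mul_inv, inv_div]
  have : (1 - q ^ 2) * (1 - q ^ 2)⁻¹ = 1 := mul_inv_cancel₀ hpos.ne'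
  simp only [div_eq_mul_inv]
  linear_combination (-(1 - Real.exp (2 * s * Real.log q)) * qPochInfR (Real.exp (2 * s * Real.log q) * q ^ 2) (q ^ 2) * (qPochInfR (q ^ 2) (q ^ 2))⁻¹ * ((1 - q ^ 2) ^ (1 - (s + 1)))⁻¹) * this

noncomputable def auxT (q ν z : ℝ) (k : ℕ) : ℝ :=
  q ^ (2 * (k : ℝ) * (ν + k)) * (1 - q ^ 2) ^ k * (z / 2) ^ (ν + 2 * (k : ℝ)) /
    (qPochR (q ^ 2) (q ^ 2) k * qGamma2 q (ν + k + 1))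

lemma auxT_scale (q ν z c : ℝ) (hc : 0 < c) (hz : 0 < z) (k : ℕ) :
    auxT q ν (c * z) k = auxT q ν z k * (c ^ ν * c ^ (2 * k)) := by
  unfold auxT
  have : (c * z / 2) ^ (ν + 2 * (k : ℝ)) = (z / 2) ^ (ν + 2 * (k : ℝ)) * (c ^ ν * c ^ (2 * k)) := by
    rw [mul_div_assoc, Real.mul_rpow hc.le (by positivity), Real.rpow_add hc,
      ← Real.rpow_natCast c (2 * k)]
    push_cast
    ring
  rw [this]
  ring

lemma auxT_succ (q ν z : ℝ) (hq0 : 0 < q) (hq1 : q < 1) (hz : 0 < z) (k : ℕ) :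
    auxT q ν z (k + 1) * ((1 - q ^ (2 * k + 2)) * (1 - (q ^ ν) ^ 2 * q ^ (2 * k + 2))) =
      (q ^ ν) ^ 2 * q ^ (4 * k + 2) * (1 - q ^ 2) ^ 2 * (z / 2) ^ 2 * auxT q ν z k := by
  have hG := aux_G q (ν + k + 1) hq0 hq1
  have he : Real.exp (2 * (ν + k + 1) * Real.log q) = (q ^ ν) ^ 2 * q ^ (2 * k + 2) := by
    rw [← Real.rpow_natCast q (2 * k + 2), ← Real.rpow_natCast (q ^ ν) 2, ← Real.rpow_mul hq0.le,
      ← Real.rpow_add hq0, Real.rpow_def_of_pos hq0]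
    congr 1; push_cast; ring
  rw [he] at hG
  have h1 : q ^ (2 * ((k + 1 : ℕ) : ℝ) * (ν + (k + 1 : ℕ))) =
      q ^ (2 * (k : ℝ) * (ν + k)) * ((q ^ ν) ^ 2 * q ^ (4 * k + 2)) := by
    rw [← Real.rpow_natCast q (4 * k + 2), ← Real.rpow_natCast (q ^ ν) 2, ← Real.rpow_mul hq0.le,
      ← Real.rpow_add hq0, ← Real.rpow_add hq0]
    congr 1; push_cast; ring
  have h2 : (z / 2) ^ (ν + 2 * ((k + 1 : ℕ) : ℝ)) = (z / 2) ^ (ν + 2 * (k : ℝ)) * (z / 2) ^ 2 := by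
    rw [← Real.rpow_natCast (z / 2) 2, ← Real.rpow_add (by positivity)]
    congr 1; push_cast; ring
  have h3 : qPochR (q ^ 2) (q ^ 2) (k + 1) =
      qPochR (q ^ 2) (q ^ 2) k * (1 - q ^ (2 * k + 2)) := by
    unfold qPochR
    rw [Finset.prod_range_succ]
    congr 2
    ring
  have h4 : (1 - q ^ (2 * k + 2)) * (1 - q ^ (2 * k + 2))⁻¹ = 1 := by
    apply mul_inv_cancel₀
    have : q ^ (2 * k + 2) < 1 := pow_lt_one₀ hq0.le hq1 (by omega)
    linarith
  have h5 : ν + ((k + 1 : ℕ) : ℝ) + 1 = ν + k + 1 + 1 := by push_cast; ring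
  unfold auxT
  rw [h1, h2, h3, h5]
  simp only [div_eq_mul_inv _ (_ * qGamma2 _ _), mul_inv]
  generalize (qGamma2 q (ν + k + 1 + 1))⁻¹ = G1 at *
  generalize (qGamma2 q (ν + k + 1))⁻¹ = G0 at *
  generalize (1 - q ^ (2 * k + 2))⁻¹ = J at *
  generalize (z / 2) ^ (ν + 2 * (k : ℝ)) = Z at *
  generalize q ^ (2 * (k : ℝ) * (ν + k)) = Q at *
  generalize (qPochR (q ^ 2) (q ^ 2) k)⁻¹ = R at *
  rw [pow_succ (1 - q ^ 2) k]
  set W := Q * ((q ^ ν) ^ 2 * q ^ (4 * k + 2)) * ((1 - q ^ 2) ^ k * (1 - q ^ 2)) * (Z * (z / 2) ^ 2) * R with hW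
  calc _ = W * ((1 - q ^ (2 * k + 2)) * J) * (G1 * (1 - (q ^ ν) ^ 2 * q ^ (2 * k + 2))) := by
        rw [hW]; ring
    _ = _ := by rw [h4, hG, hW]; ring

open Filter Topology in
lemma auxT_summable (q ν z : ℝ) (hq0 : 0 < q) (hq1 : q < 1) (hz : 0 < z) :
    Summable (auxT q ν z) := by
  have hx : Tendsto (fun k : ℕ => q ^ k) atTop (𝓝 0) :=
    tendsto_pow_atTop_nhds_zero_of_lt_one hq0.le hq1
  have hD : Tendsto (fun k : ℕ => (1 - (q ^ k) ^ 2 * q ^ 2) * (1 - (q ^ ν) ^ 2 * ((q ^ k) ^ 2 * q ^ 2)))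
      atTop (𝓝 ((1 - 0 ^ 2 * q ^ 2) * (1 - (q ^ ν) ^ 2 * (0 ^ 2 * q ^ 2)))) :=
    (((hx.pow 2).mul_const _).const_sub 1).mul
      ((((hx.pow 2).mul_const _).const_mul _).const_sub 1)
  have hN : Tendsto (fun k : ℕ => (q ^ ν) ^ 2 * ((q ^ k) ^ 4 * q ^ 2) * (1 - q ^ 2) ^ 2 * (z / 2) ^ 2)
      atTop (𝓝 ((q ^ ν) ^ 2 * (0 ^ 4 * q ^ 2) * (1 - q ^ 2) ^ 2 * (z / 2) ^ 2)) :=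
    ((((hx.pow 4).mul_const _).const_mul _).mul_const _).mul_const _
  have hD' := hD.eventually_const_lt (u := 1/2) (by norm_num)
  have hN' := hN.eventually_lt_const (u := 1/4) (by norm_num)
  refine summable_of_ratio_norm_eventually_le (r := 1/2) (by norm_num) ?_
  filter_upwards [hD', hN'] with k hd hn
  have h := auxT_succ q ν z hq0 hq1 hz k
  rw [show q ^ (2 * k + 2) = (q ^ k) ^ 2 * q ^ 2 by ring,
    show q ^ (4 * k + 2) = (q ^ k) ^ 4 * q ^ 2 by ring] at h
  have hn0 : 0 ≤ (q ^ ν) ^ 2 * ((q ^ k) ^ 4 * q ^ 2) * (1 - q ^ 2) ^ 2 * (z / 2) ^ 2 := by positivity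
  have h' := congrArg norm h
  rw [norm_mul, norm_mul _ (auxT q ν z k), Real.norm_of_nonneg hn0,
    Real.norm_of_nonneg (by linarith : (0:ℝ) ≤ (1 - (q ^ k) ^ 2 * q ^ 2) * (1 - (q ^ ν) ^ 2 * ((q ^ k) ^ 2 * q ^ 2)))] at h'
  have a1 := mul_le_mul_of_nonneg_left hd.le (norm_nonneg (auxT q ν z (k+1)))
  have a2 := mul_le_mul_of_nonneg_right hn.le (norm_nonneg (auxT q ν z k))
  linarith

/-- `f(z) = I^{(2)}_ν((1-q²)z;q²)` satisfies the q-difference equation (3.15):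
`f(q^{-1}z) - (q^{-ν}+q^ν) f(z) + [1 - (1-q²)²z²/4] f(qz) = 0`. -/
theorem stmt10 (q : ℝ) (hq0 : 0 < q) (hq1 : q < 1) (ν : ℝ)
    (h1 : ∀ m : ℤ, m < 0 → ν ≠ m)
    (z : ℝ) (hz0 : 0 < z) :
    I2 q ν (q⁻¹ * z) - (q ^ (-ν) + q ^ ν) * I2 q ν z
      + (1 - (1 - q ^ 2) ^ 2 * z ^ 2 / 4) * I2 q ν (q * z) = 0 := by
  have hI : ∀ y, I2 q ν y = ∑' k, auxT q ν y k := fun y => rfl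
  have hqi : 0 < q⁻¹ := inv_pos.mpr hq0
  have s0 := auxT_summable q ν z hq0 hq1 hz0
  have s1 := auxT_summable q ν (q * z) hq0 hq1 (by positivity)
  have s2 := auxT_summable q ν (q⁻¹ * z) hq0 hq1 (by positivity)
  have sg := (s2.sub (s0.mul_left (q ^ (-ν) + q ^ ν))).add s1
  have e1 : ∑' k, (auxT q ν (q⁻¹ * z) k - (q ^ (-ν) + q ^ ν) * auxT q ν z k + auxT q ν (q * z) k)
      = I2 q ν (q⁻¹ * z) - (q ^ (-ν) + q ^ ν) * I2 q ν z + I2 q ν (q * z) := by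
    rw [(s2.sub (s0.mul_left (q ^ (-ν) + q ^ ν))).tsum_add s1,
      s2.tsum_sub (s0.mul_left (q ^ (-ν) + q ^ ν)), tsum_mul_left]
    rfl
  have e2 : ∑' k, (1 - q ^ 2) ^ 2 * z ^ 2 / 4 * auxT q ν (q * z) k
      = (1 - q ^ 2) ^ 2 * z ^ 2 / 4 * I2 q ν (q * z) := by
    rw [tsum_mul_left]; rfl
  have hw : 0 < q ^ ν := Real.rpow_pos_of_pos hq0 ν
  have hwi : (q⁻¹) ^ ν = (q ^ ν)⁻¹ := Real.inv_rpow hq0.le ν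
  have hwn : q ^ (-ν) = (q ^ ν)⁻¹ := Real.rpow_neg hq0.le ν
  have e3 : ∑' k, (auxT q ν (q⁻¹ * z) k - (q ^ (-ν) + q ^ ν) * auxT q ν z k + auxT q ν (q * z) k)
      = ∑' k, (1 - q ^ 2) ^ 2 * z ^ 2 / 4 * auxT q ν (q * z) k := by
    rw [Summable.tsum_eq_zero_add sg]
    have z0 : auxT q ν (q⁻¹ * z) 0 - (q ^ (-ν) + q ^ ν) * auxT q ν z 0 + auxT q ν (q * z) 0 = 0 := by
      rw [auxT_scale q ν z _ hqi hz0, auxT_scale q ν z _ hq0 hz0, hwi, hwn]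
      simp only [mul_zero, pow_zero]
      ring
    rw [z0, zero_add]
    congr 1
    ext k
    have h := auxT_succ q ν z hq0 hq1 hz0 k
    rw [auxT_scale q ν z _ hqi hz0, auxT_scale q ν z _ hq0 hz0, auxT_scale q ν z _ hq0 hz0, hwi, hwn]
    rw [show q ^ (2 * k + 2) = (q ^ k) ^ 2 * q ^ 2 by ring,
      show q ^ (4 * k + 2) = (q ^ k) ^ 4 * q ^ 2 by ring] at h
    rw [show (q⁻¹) ^ (2 * (k + 1)) = ((q ^ k) ^ 2 * q ^ 2)⁻¹ by rw [inv_pow]; congr 1; ring,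
      show q ^ (2 * (k + 1)) = (q ^ k) ^ 2 * q ^ 2 by ring, show q ^ (2 * k) = (q ^ k) ^ 2 by ring]
    have hx : 0 < q ^ k := by positivity
    generalize q ^ k = x at *
    generalize q ^ ν = w at *
    generalize auxT q ν z (k+1) = A at *
    generalize auxT q ν z k = B at *
    have hne : w * (x ^ 2 * q ^ 2) ≠ 0 := by positivity
    apply mul_left_cancel₀ hne
    have i1 : w * w⁻¹ = 1 := mul_inv_cancel₀ hw.ne'
    have i2 : (x ^ 2 * q ^ 2) * (x ^ 2 * q ^ 2)⁻¹ = 1 := mul_inv_cancel₀ (by positivity)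
    calc _ = A * ((w * w⁻¹) * ((x ^ 2 * q ^ 2) * (x ^ 2 * q ^ 2)⁻¹) - (w * w⁻¹ + w ^ 2) * (x ^ 2 * q ^ 2) + w ^ 2 * (x ^ 2 * q ^ 2) ^ 2) := by ring
      _ = _ := by rw [i1, i2]; linear_combination h
  linear_combination (e3.symm.trans e1).symm.trans e2
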